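/- arXiv:2210.16733 — 2 statements merged into one kernel-verified Lean document; each statement's English description precedes it below -/
import Mathlib

section
/- Let d ≥ 1, a, b ∈ (0, d/2) and 0 ≤ c < min{a, b, a + b − d/2}. There is a constant C > 0, depending only on d, a, b, c, such that for every family (û_m)_{m ∈ ℤ^d₀} of complex vectors (extended by 0 at the index 0) with ‖u‖_{H^{−c}} < ∞, one has ∑_{k, l ∈ ℤ^d₀} |k|^{−2a} |l|^{−2b} |û_{k−l}|² ≤ C ‖u‖²_{H^{−c}}. -/
open scoped ENNReal

/-- Euclidean norm of a lattice point `k ∈ ℤ^d`. -/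
noncomputable def znorm {d : ℕ} (k : Fin d → ℤ) : ℝ :=
  Real.sqrt (∑ i, ((k i : ℝ)) ^ 2)

theorem znorm_eq_norm {d : ℕ} (k : Fin d → ℤ) :
    znorm k = ‖(WithLp.toLp 2 fun i ↦ (k i : ℝ) : EuclideanSpace ℝ (Fin d))‖ := by
  simp [znorm, EuclideanSpace.norm_eq]

theorem znorm_nonneg {d : ℕ} (k : Fin d → ℤ) : 0 ≤ znorm k :=
  Real.sqrt_nonneg _

theorem znorm_pos {d : ℕ} {k : Fin d → ℤ} (hk : k ≠ 0) : 0 < znorm k := by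
  rw [znorm_eq_norm, norm_pos_iff]
  contrapose! hk
  funext i
  simpa using congrArg (fun v : EuclideanSpace ℝ (Fin d) ↦ v i) hk

theorem znorm_sub_le {d : ℕ} (k l : Fin d → ℤ) : znorm (k - l) ≤ znorm k + znorm l := by
  simp only [znorm_eq_norm]
  convert! norm_sub_le _ _ using 2
  ext i
  simp

theorem summable_znorm_rpow (d : ℕ) {r : ℝ} (hr : r < -d) :
    Summable fun k : Fin d → ℤ ↦ znorm k ^ r := by
  let e := (EuclideanSpace.basisFun (Fin d) ℝ).toBasis
  let b := e.restrictScalars ℤ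
  have hfin : Module.finrank ℤ (Submodule.span ℤ (Set.range e)) = d := by
    simpa using Module.finrank_eq_card_basis b
  have h := ZLattice.summable_norm_rpow (Submodule.span ℤ (Set.range e)) r (by rwa [hfin])
  refine (b.equivFun.symm.toEquiv.summable_iff.mpr h).congr fun k ↦ ?_
  have hk : ((b.equivFun.symm k : Submodule.span ℤ (Set.range e)) : EuclideanSpace ℝ (Fin d)) =
      WithLp.toLp 2 fun i ↦ (k i : ℝ) := by
    have hb (i : Fin d) : (b i : EuclideanSpace ℝ (Fin d)) = EuclideanSpace.single i 1 :=
      (e.restrictScalars_apply ℤ i).trans (by simp [e])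
    ext j
    rw [Module.Basis.equivFun_symm_apply, Submodule.coe_sum]
    simp_rw [Submodule.coe_smul, hb]
    simp [Pi.single_apply]
  rw [znorm_eq_norm, ← hk]
  rfl

/-- Peetre-type splitting: the larger of `x` and `y` absorbs the weight `(z / 2) ^ (-2 * c)`. -/
theorem rpow_mul_rpow_le_of_le {a b c x y z : ℝ} (ha : 0 < a) (hc : 0 ≤ c) (hcb : c < b)
    (hx : 0 ≤ x) (hz : 0 < z) (hxy : x ≤ y) (hzxy : z ≤ x + y) :
    x ^ (-2 * a) * y ^ (-2 * b) ≤ (z / 2) ^ (-2 * c) * x ^ (-2 * (a + b - c)) := by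
  rcases hx.eq_or_lt with rfl | hx
  · rw [Real.zero_rpow (by linarith), zero_mul]
    positivity
  have hy : 0 < y := hx.trans_le hxy
  calc
    x ^ (-2 * a) * y ^ (-2 * b) = y ^ (-2 * c) * (x ^ (-2 * a) * y ^ (-2 * (b - c))) := by
      rw [mul_left_comm, ← Real.rpow_add hy]
      ring_nf
    _ ≤ (z / 2) ^ (-2 * c) * (x ^ (-2 * a) * x ^ (-2 * (b - c))) := by
      gcongr ?_ * (_ * ?_)
      · exact Real.rpow_le_rpow_of_nonpos (by positivity) (by linarith) (by linarith)
      · exact Real.rpow_le_rpow_of_nonpos hx hxy (by linarith)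
    _ = (z / 2) ^ (-2 * c) * x ^ (-2 * (a + b - c)) := by
      rw [← Real.rpow_add hx]
      ring_nf

theorem rpow_mul_rpow_le {a b c x y z : ℝ} (hc : 0 ≤ c) (hca : c < a) (hcb : c < b)
    (hx : 0 ≤ x) (hy : 0 ≤ y) (hz : 0 < z) (hzxy : z ≤ x + y) :
    x ^ (-2 * a) * y ^ (-2 * b) ≤
      (z / 2) ^ (-2 * c) * (x ^ (-2 * (a + b - c)) + y ^ (-2 * (a + b - c))) := by
  rw [mul_add]
  rcases le_total x y with h | h
  · exact (rpow_mul_rpow_le_of_le (hc.trans_lt hca) hc hcb hx hz h hzxy).trans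
      (le_add_of_nonneg_right (by positivity))
  · have := rpow_mul_rpow_le_of_le (hc.trans_lt hcb) hc hca hy hz h (by linarith)
    rw [mul_comm, add_comm b a] at this
    exact this.trans (le_add_of_nonneg_left (by positivity))

/-- Discrete convolution estimate for the weights `|k| ^ (-2a)` and `|l| ^ (-2b)`. -/
theorem tsum_znorm_rpow_mul_le {d : ℕ} {a b c : ℝ} (hc : 0 ≤ c) (hca : c < a) (hcb : c < b)
    (habc : c < a + b - d / 2) {m : Fin d → ℤ} (hm : m ≠ 0) :
    ∑' l : Fin d → ℤ,
        ENNReal.ofReal (znorm (m + l) ^ (-(2 : ℝ) * a) * znorm l ^ (-(2 : ℝ) * b)) ≤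
      ENNReal.ofReal ((4 * Real.pi) ^ (2 * c) *
          (2 * ∑' l : Fin d → ℤ, znorm l ^ (-2 * (a + b - c)))) *
        ENNReal.ofReal ((2 * Real.pi * znorm m) ^ (-(2 : ℝ) * c)) := by
  set r := -2 * (a + b - c) with hr
  have hsum : Summable fun l : Fin d → ℤ ↦ znorm l ^ r :=
    summable_znorm_rpow d (by rw [hr]; linarith)
  have hnn : ∀ l : Fin d → ℤ, 0 ≤ znorm l ^ r := fun l ↦ Real.rpow_nonneg (znorm_nonneg l) r
  have hz := znorm_pos hm
  have hscale : (znorm m / 2) ^ (-2 * c) =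
      (4 * Real.pi) ^ (2 * c) * (2 * Real.pi * znorm m) ^ (-(2 : ℝ) * c) := by
    have h : znorm m / 2 = (4 * Real.pi)⁻¹ * (2 * Real.pi * znorm m) := by
      field_simp
      ring
    rw [h, Real.mul_rpow (by positivity) (by positivity), Real.inv_rpow (by positivity),
      ← Real.rpow_neg (by positivity)]
    ring_nf
  have hsum' : Summable fun l : Fin d → ℤ ↦ znorm (m + l) ^ r :=
    (Equiv.addLeft m).summable_iff.mpr hsum
  have hshift : ∑' l : Fin d → ℤ, znorm (m + l) ^ r = ∑' l : Fin d → ℤ, znorm l ^ r :=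
    (Equiv.addLeft m).tsum_eq fun l : Fin d → ℤ ↦ znorm l ^ r
  calc
    _ ≤ ∑' l : Fin d → ℤ,
        ENNReal.ofReal ((znorm m / 2) ^ (-2 * c) * (znorm (m + l) ^ r + znorm l ^ r)) := by
      refine ENNReal.tsum_le_tsum fun l ↦ ENNReal.ofReal_le_ofReal ?_
      refine rpow_mul_rpow_le hc hca hcb (znorm_nonneg _) (znorm_nonneg _) hz ?_
      simpa using znorm_sub_le (m + l) l
    _ = ENNReal.ofReal ((znorm m / 2) ^ (-2 * c) *
        (2 * ∑' l : Fin d → ℤ, znorm l ^ r)) := by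
      rw [← ENNReal.ofReal_tsum_of_nonneg
        (fun l ↦ mul_nonneg (by positivity) (add_nonneg (hnn _) (hnn _)))
        ((hsum'.add hsum).mul_left _), tsum_mul_left, hsum'.tsum_add hsum, hshift, two_mul]
    _ = _ := by
      rw [← ENNReal.ofReal_mul (mul_nonneg (by positivity)
        (mul_nonneg zero_le_two (tsum_nonneg hnn))), hscale]
      ring_nf

theorem ENNReal.tsum_tsum_mul_sub {G : Type*} [AddCommGroup G] (w : G → G → ℝ≥0∞)
    (f : G → ℝ≥0∞) :
    ∑' k, ∑' l, w k l * f (k - l) = ∑' m, (∑' l, w (m + l) l) * f m := by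
  rw [ENNReal.tsum_comm]
  simp_rw [← ENNReal.tsum_mul_right]
  rw [ENNReal.tsum_comm (f := fun m l ↦ w (m + l) l * f m)]
  refine tsum_congr fun l ↦ ?_
  rw [← (Equiv.addRight l).tsum_eq]
  simp

/-- for `a, b ∈ (0, d/2)` and `0 ≤ c < min{a, b, a+b-d/2}`,
`∑_{k,l} |k|^{-2a} |l|^{-2b} |û_{k-l}|² ≲ ‖u‖²_{H^{-c}}`, where
`‖u‖²_{H^s} = ∑_k |2πk|^{2s} |û_k|²` and `û` vanishes at the index `0`. -/
theorem stmt2 {d : ℕ} (hd : 1 ≤ d) (a b c : ℝ)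
    (ha : 0 < a ∧ a < d / 2) (hb : 0 < b ∧ b < d / 2)
    (hc : 0 ≤ c ∧ c < min a (min b (a + b - d / 2))) :
    ∃ C : ℝ, 0 < C ∧
      ∀ u : (Fin d → ℤ) → EuclideanSpace ℂ (Fin d), u 0 = 0 →
        (∑' k : Fin d → ℤ,
            ENNReal.ofReal ((2 * Real.pi * znorm k) ^ (-(2 : ℝ) * c)) *
              (‖u k‖₊ : ℝ≥0∞) ^ 2) ≠ ∞ →
        (∑' k : Fin d → ℤ, ∑' l : Fin d → ℤ,
            ENNReal.ofReal (znorm k ^ (-(2 : ℝ) * a) * znorm l ^ (-(2 : ℝ) * b)) *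
              (‖u (k - l)‖₊ : ℝ≥0∞) ^ 2) ≤
          ENNReal.ofReal C *
            ∑' k : Fin d → ℤ,
              ENNReal.ofReal ((2 * Real.pi * znorm k) ^ (-(2 : ℝ) * c)) *
                (‖u k‖₊ : ℝ≥0∞) ^ 2 := by
  obtain ⟨hc0, hc⟩ := hc
  obtain ⟨hca, hcb, habc⟩ := by simpa only [lt_min_iff] using hc
  set M := (4 * Real.pi) ^ (2 * c) * (2 * ∑' l : Fin d → ℤ, znorm l ^ (-2 * (a + b - c)))
  have hM : 0 ≤ M := mul_nonneg (by positivity)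
    (mul_nonneg zero_le_two (tsum_nonneg fun l ↦ Real.rpow_nonneg (znorm_nonneg l) _))
  refine ⟨M + 1, by positivity, fun u hu _ ↦ ?_⟩
  rw [ENNReal.tsum_tsum_mul_sub
    (fun k l ↦ ENNReal.ofReal (znorm k ^ (-(2 : ℝ) * a) * znorm l ^ (-(2 : ℝ) * b)))
    (fun m ↦ (‖u m‖₊ : ℝ≥0∞) ^ 2), ← ENNReal.tsum_mul_left]
  refine ENNReal.tsum_le_tsum fun m ↦ ?_
  rcases eq_or_ne m 0 with rfl | hm
  · simp [hu]
  rw [← mul_assoc]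
  gcongr
  refine (tsum_znorm_rpow_mul_le hc0 hca hcb habc hm).trans ?_
  gcongr
  exact le_add_of_nonneg_right zero_le_one
end

section
/- Let d ∈ {2, 3} and b ∈ (0, d/2). There is a constant C > 0, depending only on d and b, such that for all families (V̂_j)_{j ∈ ℤ^d₀} of vectors in ℂ^d and (f̂_j)_{j ∈ ℤ^d₀} of complex numbers (each extended by 0 at the index 0), one has ∑_{k ∈ ℤ^d₀} |2πk|^{−2b} (∑_{j ∈ ℤ^d₀} |V̂_j| |f̂_{k−j}|)² ≤ C ‖V‖²_{H^{d/2−b}} ‖f‖²_{L²}, where ‖f‖²_{L²} := ∑_{k ∈ ℤ^d₀} |f̂_k|². (For a divergence-free vector field V, i.e. j·V̂_j = 0 for all j, this yields the transport estimate ‖V·∇f‖_{H^{−1−b}} ≲ ‖V‖_{H^{d/2−b}} ‖f‖_{L²}.) -/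
open scoped ENNReal

theorem abs_le_znorm {d : ℕ} (k : Fin d → ℤ) (i : Fin d) : |(k i : ℝ)| ≤ znorm k :=
  Real.abs_le_sqrt
    (Finset.single_le_sum (f := fun i => (k i : ℝ) ^ 2) (fun _ _ => sq_nonneg _)
      (Finset.mem_univ i))

theorem one_le_znorm {d : ℕ} {k : Fin d → ℤ} (hk : k ≠ 0) : 1 ≤ znorm k := by
  obtain ⟨i, hi⟩ := Function.ne_iff.mp hk
  refine le_trans ?_ (abs_le_znorm k i)
  exact_mod_cast Int.one_le_abs hi

theorem znorm_zero {d : ℕ} : znorm (0 : Fin d → ℤ) = 0 := by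
  simp [znorm]

theorem two_pi_znorm_pos {d : ℕ} {k : Fin d → ℤ} (hk : k ≠ 0) : 0 < 2 * Real.pi * znorm k :=
  mul_pos Real.two_pi_pos (one_pos.trans_le (one_le_znorm hk))

theorem sum_range_rpow_neg_le {θ : ℝ} (h0 : 0 ≤ θ) (h1 : θ < 1) (M : ℕ) :
    ∑ n ∈ Finset.range M, ((n : ℝ) + 1) ^ (-θ) ≤ (M : ℝ) ^ (1 - θ) / (1 - θ) := by
  have hθ : 0 < 1 - θ := by linarith
  induction M with
  | zero => simp [Real.zero_rpow hθ.ne']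
  | succ m ih =>
    rw [Finset.sum_range_succ]
    have hm : (0 : ℝ) < (m : ℝ) + 1 := by positivity
    have bern := rpow_one_add_le_one_add_mul_self (s := -((m : ℝ) + 1)⁻¹) (p := 1 - θ)
      (neg_le_neg (inv_le_one_of_one_le₀ (by linarith [(Nat.cast_nonneg m : (0 : ℝ) ≤ m)])))
      hθ.le (by linarith)
    have hfac : (m : ℝ) = (m + 1) * (1 + -((m : ℝ) + 1)⁻¹) := by field_simp; ring
    have hnn : (0 : ℝ) ≤ 1 + -((m : ℝ) + 1)⁻¹ := by
      have := inv_le_one_of_one_le₀ (show (1 : ℝ) ≤ (m : ℝ) + 1 by simp)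
      linarith
    have hstep : (m : ℝ) ^ (1 - θ) ≤ ((m : ℝ) + 1) ^ (1 - θ) - (1 - θ) * ((m : ℝ) + 1) ^ (-θ) := by
      have hsplit : ((m : ℝ) + 1) ^ (1 - θ) = (m + 1) * ((m : ℝ) + 1) ^ (-θ) := by
        rw [sub_eq_add_neg, Real.rpow_add hm, Real.rpow_one]
      calc (m : ℝ) ^ (1 - θ)
          = ((m : ℝ) + 1) ^ (1 - θ) * (1 + -((m : ℝ) + 1)⁻¹) ^ (1 - θ) := by
            rw [← Real.mul_rpow hm.le hnn, ← hfac]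
        _ ≤ ((m : ℝ) + 1) ^ (1 - θ) * (1 + (1 - θ) * -((m : ℝ) + 1)⁻¹) := by gcongr
        _ = _ := by rw [hsplit]; field_simp; ring
    rw [le_div_iff₀ hθ] at ih ⊢
    push_cast
    linarith

theorem sum_Icc_rpow_neg_le {θ : ℝ} (h0 : 0 ≤ θ) (h1 : θ < 1) {M : ℕ} (hM : 1 ≤ M) :
    ∑ n ∈ Finset.Icc (-(M : ℤ)) M, (max 1 |(n : ℝ)|) ^ (-θ) ≤
      3 / (1 - θ) * (M : ℝ) ^ (1 - θ) := by
  have hθ : 0 < 1 - θ := by linarith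
  have key : ∀ m : ℕ, ∑ n ∈ Finset.Icc (-(m : ℤ)) m, (max 1 |(n : ℝ)|) ^ (-θ) =
      1 + 2 * ∑ n ∈ Finset.range m, ((n : ℝ) + 1) ^ (-θ) := by
    intro m
    induction m with
    | zero => simp
    | succ m ih =>
      have hset : Finset.Icc (-((m + 1 : ℕ) : ℤ)) ((m + 1 : ℕ) : ℤ) =
          insert (-((m + 1 : ℕ) : ℤ)) (insert ((m + 1 : ℕ) : ℤ) (Finset.Icc (-(m : ℤ)) m)) := by
        ext x; simp only [Finset.mem_Icc, Finset.mem_insert]; omega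
      have habs : |(m : ℝ) + 1| = m + 1 := abs_of_nonneg (by positivity)
      have habs' : |-1 + -(m : ℝ)| = m + 1 := by
        rw [← habs, ← abs_neg]; congr 1; ring
      rw [hset, Finset.sum_insert, Finset.sum_insert, ih, Finset.sum_range_succ]
      · simp [habs, habs']; ring
      · simp
      · simp only [Finset.mem_Icc, Finset.mem_insert]; omega
  have hM' : (1 : ℝ) ≤ (M : ℝ) ^ (1 - θ) := Real.one_le_rpow (by exact_mod_cast hM) hθ.le
  have h1' : (1 : ℝ) ≤ (M : ℝ) ^ (1 - θ) / (1 - θ) := by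
    rw [le_div_iff₀ hθ]; linarith
  rw [key]
  have := sum_range_rpow_neg_le h0 h1 M
  calc _ ≤ 3 * ((M : ℝ) ^ (1 - θ) / (1 - θ)) := by linarith
    _ = _ := by ring

theorem znorm_rpow_neg_le_prod {d : ℕ} (hd : 0 < d) {t : ℝ} (ht : 0 ≤ t) {j : Fin d → ℤ}
    (hj : j ≠ 0) : znorm j ^ (-t) ≤ ∏ i, (max 1 |(j i : ℝ)|) ^ (-(t / d)) := by
  have hd' : (d : ℝ) ≠ 0 := by exact_mod_cast hd.ne'
  have hz : 0 < znorm j := one_pos.trans_le (one_le_znorm hj)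
  calc znorm j ^ (-t) = ∏ _i : Fin d, znorm j ^ (-(t / d)) := by
        rw [Finset.prod_const, Finset.card_univ, Fintype.card_fin, ← Real.rpow_natCast,
          ← Real.rpow_mul hz.le]
        congr 1; field_simp
    _ ≤ _ := by
        refine Finset.prod_le_prod (fun _ _ => by positivity) fun i _ => ?_
        exact Real.rpow_le_rpow_of_nonpos (by positivity)
          (max_le (one_le_znorm hj) (abs_le_znorm j i)) (by simp; positivity)

theorem tsum_znorm_le_rpow_neg_le {d : ℕ} (hd : 0 < d) {t : ℝ} (ht : 0 < t) (htd : t < d) :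
    ∃ C : ℝ, 0 < C ∧ ∀ k : Fin d → ℤ,
      ∑' j : Fin d → ℤ, (if znorm j ≤ znorm k then
          ENNReal.ofReal ((2 * Real.pi * znorm j) ^ (-t)) else 0) ≤
        ENNReal.ofReal (C * (2 * Real.pi * znorm k) ^ ((d : ℝ) - t)) := by
  have hd' : (0 : ℝ) < d := by exact_mod_cast hd
  have hθ0 : 0 ≤ t / d := by positivity
  have hθ1 : t / d < 1 := (div_lt_one hd').2 htd
  have hθ : 0 < 1 - t / d := by linarith
  have hpi : 0 < 2 * Real.pi := Real.two_pi_pos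
  refine ⟨(2 * Real.pi) ^ (-(d : ℝ)) * (3 / (1 - t / d)) ^ d, by positivity, fun k => ?_⟩
  by_cases hk : k = 0
  · subst hk
    refine le_of_eq_of_le ?_ zero_le
    refine ENNReal.tsum_eq_zero.2 fun j => ?_
    by_cases hj : j = 0
    · simp [hj, znorm_zero, Real.zero_rpow (neg_ne_zero.2 ht.ne')]
    · rw [if_neg]
      rw [znorm_zero]
      linarith [one_le_znorm hj]
  have hR := one_le_znorm hk
  set M := ⌊znorm k⌋₊ with hMdef
  have hM : 1 ≤ M := Nat.one_le_floor_iff _ |>.2 hR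
  set box : Finset (Fin d → ℤ) := Fintype.piFinset fun _ => Finset.Icc (-(M : ℤ)) M
  have hbox : ∀ j : Fin d → ℤ, znorm j ≤ znorm k → j ∈ box := by
    intro j hj
    refine Fintype.mem_piFinset.2 fun i => ?_
    have h : (j i).natAbs ≤ M := by
      refine Nat.le_floor ?_
      rw [Nat.cast_natAbs, Int.cast_abs]
      exact (abs_le_znorm j i).trans hj
    rw [Finset.mem_Icc]
    omega
  rw [tsum_eq_sum (s := box) fun j hj => if_neg fun h => hj (hbox j h)]
  calc ∑ j ∈ box, (if znorm j ≤ znorm k then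
          ENNReal.ofReal ((2 * Real.pi * znorm j) ^ (-t)) else 0)
      ≤ ∑ j ∈ box, ENNReal.ofReal
          ((2 * Real.pi) ^ (-t) * ∏ i, (max 1 |(j i : ℝ)|) ^ (-(t / d))) := by
        refine Finset.sum_le_sum fun j _ => ?_
        split_ifs
        · refine ENNReal.ofReal_le_ofReal ?_
          rw [Real.mul_rpow hpi.le (znorm_nonneg j)]
          by_cases hj : j = 0
          · rw [hj, znorm_zero, Real.zero_rpow (neg_ne_zero.2 ht.ne'), mul_zero]
            positivity
          · exact mul_le_mul_of_nonneg_left (znorm_rpow_neg_le_prod hd ht.le hj) (by positivity)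
        · exact zero_le
    _ = ENNReal.ofReal ((2 * Real.pi) ^ (-t) *
          (∑ n ∈ Finset.Icc (-(M : ℤ)) M, (max 1 |(n : ℝ)|) ^ (-(t / d))) ^ d) := by
        rw [← ENNReal.ofReal_sum_of_nonneg fun j _ => by positivity, ← Finset.mul_sum,
          Finset.sum_prod_piFinset (Finset.Icc (-(M : ℤ)) M)
            fun (_ : Fin d) (n : ℤ) => (max 1 |(n : ℝ)|) ^ (-(t / d))]
        simp
    _ ≤ _ := by
        refine ENNReal.ofReal_le_ofReal ?_
        calc _ ≤ (2 * Real.pi) ^ (-t) *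
              (3 / (1 - t / d) * (znorm k) ^ (1 - t / d)) ^ d := by
              refine mul_le_mul_of_nonneg_left (pow_le_pow_left₀
                (Finset.sum_nonneg fun _ _ => by positivity)
                ((sum_Icc_rpow_neg_le hθ0 hθ1 hM).trans ?_) d) (by positivity)
              gcongr
              exact Nat.floor_le (znorm_nonneg k)
          _ = _ := by
              have e1 : ((znorm k) ^ (1 - t / d)) ^ d = znorm k ^ ((d : ℝ) - t) := by
                rw [← Real.rpow_natCast, ← Real.rpow_mul (znorm_nonneg k)]
                congr 1; field_simp
              have e2 : (2 * Real.pi) ^ (-t) =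
                  (2 * Real.pi) ^ (-(d : ℝ)) * (2 * Real.pi) ^ ((d : ℝ) - t) := by
                rw [← Real.rpow_add hpi]; congr 1; ring
              rw [mul_pow, e1, e2, Real.mul_rpow hpi.le (znorm_nonneg k)]
              ring

theorem ENNReal.sq_tsum_mul_le {ι : Type*} (a b : ι → ℝ≥0∞) :
    (∑' i, a i * b i) ^ 2 ≤ (∑' i, a i ^ 2) * ∑' i, b i ^ 2 := by
  let _ : MeasurableSpace ι := ⊤
  have h := ENNReal.lintegral_mul_le_Lp_mul_Lq (MeasureTheory.Measure.count (α := ι))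
    Real.HolderConjugate.two_two (f := a) (g := b) measurable_from_top.aemeasurable
    measurable_from_top.aemeasurable
  simp only [MeasureTheory.lintegral_count, Pi.mul_apply] at h
  calc _ ≤ _ := pow_le_pow_left' h 2
    _ = _ := by
      rw [mul_pow, ← ENNReal.rpow_mul_natCast, ← ENNReal.rpow_mul_natCast]
      simp

theorem ENNReal.add_sq_le_two_mul (a b : ℝ≥0∞) : (a + b) ^ 2 ≤ 2 * (a ^ 2 + b ^ 2) := by
  have := ENNReal.rpow_add_le_mul_rpow_add_rpow a b (p := 2) one_le_two
  norm_num at this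
  exact this

/-- for `b ∈ (0, d/2)`,
`∑_k |2πk|^{-2b} (∑_j |V̂_j| |f̂_{k-j}|)² ≲ ‖V‖²_{H^{d/2-b}} ‖f‖²_{L²}`
(Fourier-side form of the transport estimate `‖V·∇f‖_{H^{-1-b}} ≲ ‖V‖_{H^{d/2-b}}‖f‖_{L²}`). -/
theorem stmt4 {d : ℕ} (hd : d = 2 ∨ d = 3) (b : ℝ)
    (hb : 0 < b) (hbd : b < d / 2) :
    ∃ C : ℝ, 0 < C ∧
      ∀ (V : (Fin d → ℤ) → EuclideanSpace ℂ (Fin d)) (f : (Fin d → ℤ) → ℂ),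
        V 0 = 0 → f 0 = 0 →
        (∑' k : Fin d → ℤ,
            ENNReal.ofReal ((2 * Real.pi * znorm k) ^ (-(2 : ℝ) * b)) *
              (∑' j : Fin d → ℤ, (‖V j‖₊ : ℝ≥0∞) * (‖f (k - j)‖₊ : ℝ≥0∞)) ^ 2) ≤
          ENNReal.ofReal C *
            (∑' k : Fin d → ℤ,
              ENNReal.ofReal ((2 * Real.pi * znorm k) ^ (2 * ((d : ℝ) / 2 - b))) *
                (‖V k‖₊ : ℝ≥0∞) ^ 2) *
            (∑' k : Fin d → ℤ, (‖f k‖₊ : ℝ≥0∞) ^ 2) := by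
  have hd0 : 0 < d := by omega
  have hπ : ∀ k : Fin d → ℤ, 0 ≤ 2 * Real.pi * znorm k := fun k =>
    mul_nonneg Real.two_pi_pos.le (znorm_nonneg k)
  obtain ⟨C₁, hC₁, hlow⟩ := tsum_znorm_le_rpow_neg_le hd0 (t := 2 * ((d : ℝ) / 2 - b))
    (by linarith) (by linarith)
  obtain ⟨C₂, hC₂, hhigh⟩ := tsum_znorm_le_rpow_neg_le hd0 (t := 2 * b)
    (by linarith) (by linarith)
  refine ⟨2 * (C₁ + C₂), by positivity, fun V f hV _ => ?_⟩
  set W : (Fin d → ℤ) → ℝ≥0∞ := fun k =>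
    ENNReal.ofReal ((2 * Real.pi * znorm k) ^ (-(2 : ℝ) * b))
  set U : (Fin d → ℤ) → ℝ≥0∞ := fun k =>
    ENNReal.ofReal ((2 * Real.pi * znorm k) ^ (2 * ((d : ℝ) / 2 - b)))
  set v : (Fin d → ℤ) → ℝ≥0∞ := fun k => (‖V k‖₊ : ℝ≥0∞)
  set g : (Fin d → ℤ) → ℝ≥0∞ := fun k => (‖f k‖₊ : ℝ≥0∞)
  set G : ℝ≥0∞ := ∑' k, g k ^ 2
  set S : ℝ≥0∞ := ∑' k, U k * v k ^ 2 with hS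
  set A : (Fin d → ℤ) → ℝ≥0∞ := fun k =>
    ∑' j, if znorm j ≤ znorm k then v j * g (k - j) else 0
  set B : (Fin d → ℤ) → ℝ≥0∞ := fun k =>
    ∑' j, if znorm j ≤ znorm k then 0 else v j * g (k - j)
  have hAB : ∀ k, ∑' j, v j * g (k - j) = A k + B k := by
    intro k
    rw [← ENNReal.tsum_add]
    refine tsum_congr fun j => ?_
    split_ifs <;> simp
  have hA : ∑' k, W k * A k ^ 2 ≤ ENNReal.ofReal C₁ * S * G := by
    have hAk : ∀ k, W k * A k ^ 2 ≤
        ENNReal.ofReal C₁ * ∑' j, U j * v j ^ 2 * g (k - j) ^ 2 := by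
      intro k
      have hcs : A k ^ 2 ≤
          ENNReal.ofReal (C₁ * (2 * Real.pi * znorm k) ^ (2 * b)) *
            ∑' j, U j * v j ^ 2 * g (k - j) ^ 2 := by
        set p : (Fin d → ℤ) → ℝ≥0∞ := fun j => if znorm j ≤ znorm k then
          ENNReal.ofReal ((2 * Real.pi * znorm j) ^ (-((d : ℝ) / 2 - b))) else 0
        set q : (Fin d → ℤ) → ℝ≥0∞ := fun j =>
          ENNReal.ofReal ((2 * Real.pi * znorm j) ^ ((d : ℝ) / 2 - b)) * (v j * g (k - j))
        have hpq : A k = ∑' j, p j * q j := by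
          refine tsum_congr fun j => ?_
          simp only [p, q]
          split_ifs
          · by_cases hj : j = 0
            · simp [hj, v, hV]
            · have hpos := two_pi_znorm_pos hj
              rw [← mul_assoc, ← ENNReal.ofReal_mul (by positivity), ← Real.rpow_add hpos]
              simp
          · simp
        rw [hpq]
        refine (ENNReal.sq_tsum_mul_le p q).trans (mul_le_mul' ?_ ?_)
        · refine le_trans (le_of_eq (tsum_congr fun j => ?_)) ((hlow k).trans (le_of_eq ?_))
          · simp only [p]
            split_ifs
            · rw [← ENNReal.ofReal_pow (Real.rpow_nonneg (hπ j) _), ← Real.rpow_mul_natCast (hπ j)]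
              congr 2; push_cast; ring
            · simp
          · congr 3; ring
        · refine le_of_eq (tsum_congr fun j => ?_)
          simp only [q, U]
          rw [mul_pow, mul_pow, ← mul_assoc, ← ENNReal.ofReal_pow (Real.rpow_nonneg (hπ j) _),
            ← Real.rpow_mul_natCast (hπ j)]
          congr 4; push_cast; ring
      calc W k * A k ^ 2 ≤ W k * (ENNReal.ofReal (C₁ * (2 * Real.pi * znorm k) ^ (2 * b)) *
            ∑' j, U j * v j ^ 2 * g (k - j) ^ 2) := mul_le_mul_right hcs _
        _ ≤ _ := by
          rw [← mul_assoc, ← ENNReal.ofReal_mul (Real.rpow_nonneg (hπ k) _)]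
          refine mul_le_mul_left (ENNReal.ofReal_le_ofReal ?_) _
          by_cases hk : k = 0
          · rw [hk, znorm_zero, mul_zero, Real.zero_rpow (by simpa using hb.ne'), zero_mul]
            exact hC₁.le
          · refine le_of_eq ?_
            rw [mul_left_comm, ← Real.rpow_add (two_pi_znorm_pos hk)]
            simp
    calc ∑' k, W k * A k ^ 2
        ≤ ∑' k, ENNReal.ofReal C₁ * ∑' j, U j * v j ^ 2 * g (k - j) ^ 2 :=
          ENNReal.tsum_le_tsum hAk
      _ = ENNReal.ofReal C₁ * ∑' j, U j * v j ^ 2 * ∑' k, g (k - j) ^ 2 := by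
          rw [ENNReal.tsum_mul_left, ENNReal.tsum_comm]
          simp_rw [ENNReal.tsum_mul_left]
      _ = ENNReal.ofReal C₁ * S * G := by
          have hshift : ∀ j : Fin d → ℤ, ∑' k, g (k - j) ^ 2 = G := fun j =>
            (Equiv.subRight j).tsum_eq fun k => g k ^ 2
          simp_rw [hshift, ENNReal.tsum_mul_right, mul_assoc]
          rfl
  have hB : ∑' k, W k * B k ^ 2 ≤ ENNReal.ofReal C₂ * S * G := by
    have hBk : ∀ k, B k ^ 2 ≤ (∑' j, if znorm k ≤ znorm j then v j ^ 2 else 0) * G := by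
      intro k
      set p : (Fin d → ℤ) → ℝ≥0∞ := fun j => if znorm j ≤ znorm k then 0 else v j
      have hpq : B k = ∑' j, p j * g (k - j) := by
        refine tsum_congr fun j => ?_
        simp only [p]
        split_ifs <;> simp
      rw [hpq]
      refine (ENNReal.sq_tsum_mul_le p _).trans (mul_le_mul' ?_ ?_)
      · refine ENNReal.tsum_le_tsum fun j => ?_
        simp only [p]
        split_ifs with h1 h2 h2
        · simp
        · simp
        · exact le_rfl
        · exact absurd (le_of_not_ge h1) h2
      · exact le_of_eq ((Equiv.subLeft k).tsum_eq fun k => g k ^ 2)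
    calc ∑' k, W k * B k ^ 2
        ≤ ∑' k, W k * ((∑' j, if znorm k ≤ znorm j then v j ^ 2 else 0) * G) :=
          ENNReal.tsum_le_tsum fun k => mul_le_mul_right (hBk k) _
      _ = (∑' j, v j ^ 2 * ∑' k, if znorm k ≤ znorm j then W k else 0) * G := by
          simp_rw [← mul_assoc, ENNReal.tsum_mul_right, ← ENNReal.tsum_mul_left]
          rw [ENNReal.tsum_comm]
          congr 1
          refine tsum_congr fun j => tsum_congr fun k => ?_
          split_ifs
          · exact mul_comm _ _
          · simp
      _ ≤ (∑' j, v j ^ 2 * (ENNReal.ofReal C₂ * U j)) * G := by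
          refine mul_le_mul_left (ENNReal.tsum_le_tsum fun j => mul_le_mul_right ?_ _) _
          rw [← ENNReal.ofReal_mul hC₂.le]
          convert hhigh j using 6
          · ring
          · ring
      _ = ENNReal.ofReal C₂ * S * G := by
          congr 1
          rw [hS, ← ENNReal.tsum_mul_left]
          exact tsum_congr fun j => mul_left_comm _ _ _ |>.trans (congrArg _ (mul_comm _ _))
  calc ∑' k, W k * (∑' j, v j * g (k - j)) ^ 2
      ≤ ∑' k, 2 * (W k * A k ^ 2 + W k * B k ^ 2) := by
        refine ENNReal.tsum_le_tsum fun k => ?_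
        rw [hAB]
        calc _ ≤ W k * (2 * (A k ^ 2 + B k ^ 2)) :=
              mul_le_mul_right (ENNReal.add_sq_le_two_mul _ _) _
          _ = _ := by ring
    _ ≤ 2 * (ENNReal.ofReal C₁ * S * G + ENNReal.ofReal C₂ * S * G) := by
        rw [ENNReal.tsum_mul_left, ENNReal.tsum_add]
        exact mul_le_mul_right (add_le_add hA hB) _
    _ = ENNReal.ofReal (2 * (C₁ + C₂)) * S * G := by
        rw [ENNReal.ofReal_mul two_pos.le, ENNReal.ofReal_add hC₁.le hC₂.le, ENNReal.ofReal_ofNat]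
        ring
end
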